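/- Second-order identities: let F be a convex class of Borel probability distributions on Ω ⊆ ℝ^d, and let T : F → A ⊆ ℝ^k be a surjective functional with a strict F-identification function V and a strictly F-consistent scoring function S satisfying assumptions (V1), (V2) and (S3). Then there exists a locally Lipschitz function h : int(A) → ℝ^{k×k} with ∂_l S̄(x,F) = Σ_{m=1}^k h_{lm}(x) V̄_m(x,F) for all l, x ∈ int(A), F ∈ F, such that for all l,m ∈ {1,…,k}, all F ∈ F and (Lebesgue-)almost all x ∈ int(A) — and in particular for x = T(F) whenever T(F) ∈ int(A) — the identities ∂_m ∂_l S̄(x,F) = Σ_{i=1}^k [∂_m h_{li}(x) V̄_i(x,F) + h_{li}(x) ∂_m V̄_i(x,F)] = Σ_{i=1}^k [∂_l h_{mi}(x) V̄_i(x,F) + h_{mi}(x) ∂_l V̄_i(x,F)] = ∂_l ∂_m S̄(x,F) hold. -/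

import Mathlib

open MeasureTheory Set

/-- A scoring function (with the required integrability) that is `𝓕`-consistent for `T`. -/
def IsConsistentScoring {E X : Type*} [MeasurableSpace E]
    (𝓕 : Set (Measure E)) (A : Set X) (T : Measure E → X) (S : X → E → ℝ) : Prop :=
  (∀ μ ∈ 𝓕, ∀ x ∈ A, Integrable (S x) μ) ∧
  ∀ μ ∈ 𝓕, ∀ x ∈ A, (∫ y, S (T μ) y ∂μ) ≤ ∫ y, S x y ∂μ

/-- A strictly `𝓕`-consistent scoring function for `T`. -/
def IsStrictlyConsistentScoring {E X : Type*} [MeasurableSpace E]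
    (𝓕 : Set (Measure E)) (A : Set X) (T : Measure E → X) (S : X → E → ℝ) : Prop :=
  IsConsistentScoring 𝓕 A T S ∧
  ∀ μ ∈ 𝓕, ∀ x ∈ A, (∫ y, S (T μ) y ∂μ) = (∫ y, S x y ∂μ) → x = T μ

/-- A strict `𝓕`-identification function for `T` (including the required integrability). -/
def IsStrictIdentification {E : Type*} [MeasurableSpace E] {k : ℕ}
    (𝓕 : Set (Measure E)) (A : Set (EuclideanSpace ℝ (Fin k)))
    (T : Measure E → EuclideanSpace ℝ (Fin k))
    (V : EuclideanSpace ℝ (Fin k) → E → EuclideanSpace ℝ (Fin k)) : Prop :=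
  (∀ μ ∈ 𝓕, ∀ x ∈ A, Integrable (V x) μ) ∧
  ∀ μ ∈ 𝓕, ∀ x ∈ A, ((∫ y, V x y ∂μ) = 0 ↔ x = T μ)

/-- A convex class of measures: stable under mixtures `(1-λ)F₀ + λF₁`, `λ ∈ (0,1)`. -/
def ConvexClass {E : Type*} [MeasurableSpace E] (𝓕 : Set (Measure E)) : Prop :=
  ∀ μ ∈ 𝓕, ∀ ν ∈ 𝓕, ∀ lam ∈ Set.Ioo (0 : ℝ) 1,
    ENNReal.ofReal (1 - lam) • μ + ENNReal.ofReal lam • ν ∈ 𝓕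

/-- `f` is locally Lipschitz continuous on the set `U`. -/
def LocLipschitzOn {α β : Type*} [PseudoEMetricSpace α] [PseudoEMetricSpace β]
    (f : α → β) (U : Set α) : Prop :=
  ∀ x ∈ U, ∃ ε > (0 : ℝ), ∃ K : NNReal, LipschitzOnWith K f (EMetric.ball x (ENNReal.ofReal ε) ∩ U)

/-- The `l`-th partial derivative of `f : ℝᵏ → ℝ` at `x`. -/
noncomputable def pd {k : ℕ} (f : EuclideanSpace ℝ (Fin k) → ℝ) (l : Fin k)
    (x : EuclideanSpace ℝ (Fin k)) : ℝ :=
  fderiv ℝ f x (EuclideanSpace.single l 1)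

/-- The chain of second-order identities
`∂ₘ∂ₗS̄(x,F) = ∑ᵢ [∂ₘh_{li}(x) V̄ᵢ(x,F) + h_{li}(x) ∂ₘV̄ᵢ(x,F)]
            = ∑ᵢ [∂ₗh_{mi}(x) V̄ᵢ(x,F) + h_{mi}(x) ∂ₗV̄ᵢ(x,F)] = ∂ₗ∂ₘS̄(x,F)`. -/
def SecondOrderId {E : Type*} [MeasurableSpace E] {k : ℕ}
    (h : EuclideanSpace ℝ (Fin k) → Fin k → Fin k → ℝ)
    (V : EuclideanSpace ℝ (Fin k) → E → EuclideanSpace ℝ (Fin k))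
    (S : EuclideanSpace ℝ (Fin k) → E → ℝ) (μ : Measure E) (l m : Fin k)
    (x : EuclideanSpace ℝ (Fin k)) : Prop :=
  pd (pd (fun z => ∫ y, S z y ∂μ) l) m x =
      (∑ i : Fin k, (pd (fun z => h z l i) m x * (∫ y, V x y ∂μ) i
        + h x l i * pd (fun z => (∫ y, V z y ∂μ) i) m x)) ∧
  (∑ i : Fin k, (pd (fun z => h z l i) m x * (∫ y, V x y ∂μ) i
        + h x l i * pd (fun z => (∫ y, V z y ∂μ) i) m x)) =
      (∑ i : Fin k, (pd (fun z => h z m i) l x * (∫ y, V x y ∂μ) i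
        + h x m i * pd (fun z => (∫ y, V z y ∂μ) i) l x)) ∧
  (∑ i : Fin k, (pd (fun z => h z m i) l x * (∫ y, V x y ∂μ) i
        + h x m i * pd (fun z => (∫ y, V z y ∂μ) i) l x)) =
      pd (pd (fun z => ∫ y, S z y ∂μ) m) l x

theorem exists_linearMap_of_convex {X Y : Type*} [NormedAddCommGroup X] [NormedSpace ℝ X]
    [AddCommGroup Y] [Module ℝ Y] {W : Set (X × Y)} (hW : Convex ℝ W)
    (h0 : ∀ w ∈ W, w.1 = 0 → w.2 = 0) (h_int : (0 : X) ∈ interior (Prod.fst '' W)) :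
    ∃ L : X →ₗ[ℝ] Y, ∀ w ∈ W, w.2 = L w.1 := by
  obtain ⟨w₀, hw₀, -⟩ := interior_subset h_int
  have hcone : ∀ a > (0 : ℝ), ∀ b > (0 : ℝ), ∀ w ∈ W, ∀ w' ∈ W,
      ∃ z ∈ W, a • w + b • w' = (a + b) • z := by
    intro a ha b hb w hw w' hw'
    refine ⟨(a / (a + b)) • w + (b / (a + b)) • w',
      hW hw hw' (by positivity) (by positivity) (by field_simp), ?_⟩
    rw [smul_add, smul_smul, smul_smul, mul_div_cancel₀ _ (by positivity),
      mul_div_cancel₀ _ (by positivity)]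
  have hspan : ∀ p ∈ Submodule.span ℝ W, ∃ a > (0 : ℝ), ∃ b > (0 : ℝ), ∃ w ∈ W, ∃ w' ∈ W,
      p = a • w - b • w' := by
    intro p hp
    induction hp using Submodule.span_induction with
    | mem w hw => exact ⟨2, by norm_num, 1, by norm_num, w, hw, w, hw, by module⟩
    | zero => exact ⟨1, by norm_num, 1, by norm_num, w₀, hw₀, w₀, hw₀, by module⟩
    | add p q _ _ hp hq =>
      obtain ⟨a, ha, b, hb, w, hw, w', hw', rfl⟩ := hp
      obtain ⟨c, hc, d, hd, u, hu, u', hu', rfl⟩ := hq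
      obtain ⟨z, hz, hz'⟩ := hcone a ha c hc w hw u hu
      obtain ⟨y, hy, hy'⟩ := hcone b hb d hd w' hw' u' hu'
      refine ⟨a + c, by positivity, b + d, by positivity, z, hz, y, hy, ?_⟩
      rw [← hz', ← hy']
      module
    | smul c p _ hp =>
      obtain ⟨a, ha, b, hb, w, hw, w', hw', rfl⟩ := hp
      rcases lt_trichotomy c 0 with hc | rfl | hc
      · exact ⟨-c * b, mul_pos (neg_pos.2 hc) hb, -c * a, mul_pos (neg_pos.2 hc) ha,
          w', hw', w, hw, by module⟩
      · exact ⟨1, by norm_num, 1, by norm_num, w₀, hw₀, w₀, hw₀, by module⟩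
      · exact ⟨c * a, by positivity, c * b, by positivity, w, hw, w', hw', by module⟩
  have hzero : ∀ a > (0 : ℝ), ∀ b > (0 : ℝ), ∀ w ∈ W, ∀ w' ∈ W,
      a • w.1 + b • w'.1 = 0 → a • w.2 + b • w'.2 = 0 := by
    intro a ha b hb w hw w' hw' h
    obtain ⟨z, hz, hz'⟩ := hcone a ha b hb w hw w' hw'
    have h1 := congrArg Prod.fst hz'
    have h2 := congrArg Prod.snd hz'
    simp only [Prod.fst_add, Prod.smul_fst, Prod.snd_add, Prod.smul_snd] at h1 h2
    rw [h, eq_comm, smul_eq_zero_iff_right (by positivity)] at h1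
    rw [h2, h0 z hz h1, smul_zero]
  have hgraph : ∀ p ∈ Submodule.span ℝ W, p.1 = 0 → p.2 = 0 := by
    intro p hp hp0
    obtain ⟨a, ha, b, hb, w, hw, w', hw', rfl⟩ := hspan p hp
    simp only [Prod.fst_sub, Prod.smul_fst, Prod.snd_sub, Prod.smul_snd] at hp0 ⊢
    have hev : ∀ᶠ c in nhdsWithin (0 : ℝ) (Ioi 0), -(c * a) • w.1 ∈ Prod.fst '' W := by
      apply nhdsWithin_le_nhds
      have hc : ContinuousAt (fun c : ℝ => -(c * a) • w.1) 0 := by fun_prop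
      apply hc
      simpa using mem_interior_iff_mem_nhds.1 h_int
    obtain ⟨c, ⟨z, hz, hzc⟩, hc⟩ := (hev.and self_mem_nhdsWithin).exists
    have hc : 0 < c := hc
    have e1 := hzero (c * a) (by positivity) 1 one_pos w hw z hz (by rw [hzc]; module)
    have e2 := hzero (c * b) (by positivity) 1 one_pos w' hw' z hz (by
      rw [hzc, ← smul_zero (-c), ← hp0]
      module)
    have e3 : c • (a • w.2 - b • w'.2) = 0 := by
      rw [← sub_self (0 : Y), ← congrArg₂ (· - ·) e1 e2]
      module
    exact (smul_eq_zero_iff_right hc.ne').1 e3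
  let f : Submodule.span ℝ W →ₗ[ℝ] X := LinearMap.fst ℝ X Y ∘ₗ (Submodule.span ℝ W).subtype
  have hinj : Function.Injective f := by
    rw [injective_iff_map_eq_zero]
    rintro ⟨p, hp⟩ h
    exact Subtype.ext (Prod.ext h (hgraph p hp h))
  have hsurj : Function.Surjective f := by
    rw [← LinearMap.range_eq_top]
    apply Submodule.eq_top_of_nonempty_interior'
    refine ⟨0, interior_mono ?_ h_int⟩
    rintro _ ⟨w, hw, rfl⟩
    exact ⟨⟨w, Submodule.subset_span hw⟩, rfl⟩
  let e := LinearEquiv.ofBijective f ⟨hinj, hsurj⟩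
  refine ⟨LinearMap.snd ℝ X Y ∘ₗ (Submodule.span ℝ W).subtype ∘ₗ e.symm.toLinearMap, ?_⟩
  intro w hw
  have : e.symm w.1 = ⟨w, Submodule.subset_span hw⟩ := by
    rw [LinearEquiv.symm_apply_eq]
    rfl
  simp [this]

theorem LipschitzOnWith.exists_comp_contDiffAt {X Y Z : Type*} [PseudoMetricSpace X]
    [NormedAddCommGroup Y] [NormedSpace ℝ Y] [NormedAddCommGroup Z] [NormedSpace ℝ Z]
    {f : X → Y} {φ : Y → Z} {x : X} {K : NNReal} {s : Set X} (hs : s ∈ nhds x)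
    (hf : LipschitzOnWith K f s) (hφ : ContDiffAt ℝ 1 φ (f x)) :
    ∃ C : NNReal, ∃ t ∈ nhds x, LipschitzOnWith C (φ ∘ f) t := by
  obtain ⟨C, t, ht, hC⟩ := hφ.exists_lipschitzOnWith
  exact ⟨C * K, s ∩ f ⁻¹' t, Filter.inter_mem hs (hf.continuousOn.continuousAt hs ht),
    hC.comp (hf.mono inter_subset_left) fun y hy => hy.2⟩

theorem HasFDerivAt.mul_of_right_eq_zero {X : Type*} [NormedAddCommGroup X] [NormedSpace ℝ X]
    {f u : X → ℝ} {u' : X →L[ℝ] ℝ} {x : X} (hf : ContinuousAt f x) (hu : HasFDerivAt u u' x)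
    (hx : u x = 0) : HasFDerivAt (fun z => f z * u z) (f x • u') x := by
  have h1 : (fun z => f z * (u z - u x - u' (z - x))) =o[nhds x] fun z => z - x := by
    have := hf.isBigO_one ℝ |>.mul_isLittleO (hasFDerivAt_iff_isLittleO.1 hu).norm_right
    simpa using this
  have h2 : (fun z => (f z - f x) * u' (z - x)) =o[nhds x] fun z => z - x := by
    have h3 : (fun z => f z - f x) =o[nhds x] fun _ => (1 : ℝ) := by
      rw [Asymptotics.isLittleO_one_iff]
      simpa using hf.sub_const (f x)
    have h4 : (fun z => u' (z - x)) =O[nhds x] fun z => ‖z - x‖ :=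
      (u'.isBigO_sub _ _).norm_right
    simpa using h3.mul_isBigO h4
  rw [hasFDerivAt_iff_isLittleO]
  refine (h1.add h2).congr_left fun z => ?_
  simp [hx]
  ring

theorem LocLipschitzOn.exists_lipschitzOnWith_nhds {X Y : Type*} [PseudoEMetricSpace X]
    [PseudoEMetricSpace Y] {f : X → Y} {U : Set X} (hf : LocLipschitzOn f U) (hU : IsOpen U)
    {x : X} (hx : x ∈ U) : ∃ K : NNReal, ∃ t ∈ nhds x, LipschitzOnWith K f t := by
  obtain ⟨ε, hε, K, hK⟩ := hf x hx
  exact ⟨K, _, Filter.inter_mem (Metric.eball_mem_nhds x (ENNReal.ofReal_pos.2 hε))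
    (hU.mem_nhds hx), hK⟩

theorem locLipschitzOn_of_exists_nhds {X Y : Type*} [PseudoEMetricSpace X]
    [PseudoEMetricSpace Y] {f : X → Y} {U : Set X}
    (hf : ∀ x ∈ U, ∃ K : NNReal, ∃ t ∈ nhds x, LipschitzOnWith K f t) : LocLipschitzOn f U := by
  intro x hx
  obtain ⟨K, t, ht, hK⟩ := hf x hx
  obtain ⟨ε, hε, hεt⟩ := EMetric.mem_nhds_iff.1 ht
  obtain ⟨δ, hδ, hδε⟩ := ENNReal.lt_iff_exists_nnreal_btwn.1 hε
  refine ⟨δ, by exact_mod_cast hδ, K, hK.mono ?_⟩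
  rw [ENNReal.ofReal_coe_nnreal]
  exact (inter_subset_left.trans (Metric.eball_subset_eball hδε.le)).trans hεt

theorem LocLipschitzOn.ae_differentiableAt {X Y : Type*} [NormedAddCommGroup X] [NormedSpace ℝ X]
    [FiniteDimensional ℝ X] [MeasurableSpace X] [BorelSpace X] [NormedAddCommGroup Y]
    [NormedSpace ℝ Y] [FiniteDimensional ℝ Y] {f : X → Y} {U : Set X} (hf : LocLipschitzOn f U)
    (hU : IsOpen U) (μ : Measure X) [μ.IsAddHaarMeasure] :
    ∀ᵐ x ∂μ, x ∈ U → DifferentiableAt ℝ f x := by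
  rw [ae_iff]
  apply measure_null_of_locally_null
  intro x hx
  have hxU : x ∈ U := by
    by_contra h
    exact hx fun h' => absurd h' h
  obtain ⟨K, t, ht, hK⟩ := hf.exists_lipschitzOnWith_nhds hU hxU
  have hae := (hK.mono interior_subset).ae_differentiableWithinAt_of_mem (μ := μ)
  refine ⟨_ ∩ interior t, inter_mem_nhdsWithin _ (interior_mem_nhds.2 ht), ?_⟩
  refine measure_mono_null ?_ (ae_iff.1 hae)
  rintro y ⟨hy, hyt⟩ h
  exact hy fun _ => (h hyt).differentiableAt (isOpen_interior.mem_nhds hyt)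

theorem exists_lipschitzOnWith_of_linear_relation {X Y ι : Type*} [NormedAddCommGroup X]
    [NormedSpace ℝ X] [FiniteDimensional ℝ X] [NormedAddCommGroup Y] [NormedSpace ℝ Y]
    {v : ι → X → X} {g : ι → X → Y} {L : X → X →L[ℝ] Y} {x : X}
    (hv : ∀ i, ContDiffAt ℝ 1 (v i) x)
    (hg : ∀ i, ∃ K : NNReal, ∃ t ∈ nhds x, LipschitzOnWith K (g i) t)
    (hL : ∀ᶠ z in nhds x, ∀ i, g i z = L z (v i z))
    (hspan : Submodule.span ℝ (range fun i => v i x) = ⊤) :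
    ∃ K : NNReal, ∃ t ∈ nhds x, LipschitzOnWith K L t := by
  obtain ⟨b, hb, hbspan, hli⟩ := exists_linearIndependent ℝ (range fun i => v i x)
  let B : Module.Basis b ℝ X := Module.Basis.mk hli (by simp [hbspan, hspan])
  have : Finite b := Module.Finite.finite_basis B
  have := Fintype.ofFinite b
  choose j hj using fun y : b => hb y.2
  simp only at hj
  have hv' : ∀ i, ∃ K : NNReal, ∃ t ∈ nhds x, LipschitzOnWith K (v i) t := fun i =>
    (hv i).exists_lipschitzOnWith
  choose K₁ t₁ ht₁ hK₁ using fun y => hg (j y)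
  choose K₂ t₂ ht₂ hK₂ using fun y => hv' (j y)
  let f : X → b → Y × X := fun z y => (g (j y) z, v (j y) z)
  let D : (b → Y × X) → (b → ℝ) →L[ℝ] Y := fun p =>
    ∑ y, (ContinuousLinearMap.proj (R := ℝ) (φ := fun _ : b => ℝ) y).smulRight (p y).1
  let M : (b → Y × X) → (b → ℝ) →L[ℝ] X := fun p =>
    ∑ y, (ContinuousLinearMap.proj (R := ℝ) (φ := fun _ : b => ℝ) y).smulRight (p y).2
  have hD : ContDiff ℝ 1 D := by
    refine ContDiff.sum fun y _ => ?_
    exact (ContinuousLinearMap.smulRightL ℝ (b → ℝ) Y (ContinuousLinearMap.proj y)).contDiff.comp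
      (contDiff_fst.comp (contDiff_apply ℝ _ y))
  have hM : ContDiff ℝ 1 M := by
    refine ContDiff.sum fun y _ => ?_
    exact (ContinuousLinearMap.smulRightL ℝ (b → ℝ) X (ContinuousLinearMap.proj y)).contDiff.comp
      (contDiff_snd.comp (contDiff_apply ℝ _ y))
  let e : (b → ℝ) ≃L[ℝ] X := B.equivFun.symm.toContinuousLinearEquiv
  have hMe : M (f x) = e := by
    ext c
    simp [M, f, e, B, hj, Module.Basis.equivFun_symm_apply]
  have hφ : ContDiffAt ℝ 1 (fun p => (D p).comp (ContinuousLinearMap.inverse (M p))) (f x) := by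
    have hinv : ContDiffAt ℝ 1 ContinuousLinearMap.inverse (M (f x)) :=
      hMe ▸ contDiffAt_map_inverse e
    exact hD.contDiffAt.clm_comp (hinv.comp (f x) hM.contDiffAt)
  have hf : LipschitzOnWith (∑ y, (K₁ y ⊔ K₂ y)) f (⋂ y, t₁ y ∩ t₂ y) := by
    intro z hz w hw
    refine edist_pi_le_iff.2 fun y => ?_
    have hz' := mem_iInter.1 hz y
    have hw' := mem_iInter.1 hw y
    refine (((hK₁ y).mono inter_subset_left).prodMk ((hK₂ y).mono inter_subset_right)
      hz' hw').trans ?_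
    gcongr
    exact Finset.single_le_sum (f := fun y => K₁ y ⊔ K₂ y) (fun _ _ => zero_le)
      (Finset.mem_univ y)
  have hfn : (⋂ y, t₁ y ∩ t₂ y) ∈ nhds x :=
    Filter.iInter_mem.2 fun y => Filter.inter_mem (ht₁ y) (ht₂ y)
  obtain ⟨C, t, ht, hC⟩ := hf.exists_comp_contDiffAt hfn hφ
  have hinv : ∀ᶠ z in nhds x, M (f z) ∈ range ((↑) : ((b → ℝ) ≃L[ℝ] X) → (b → ℝ) →L[ℝ] X) := by
    have hc : ContinuousAt (fun z => M (f z)) x :=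
      hM.continuous.continuousAt.comp (hf.continuousOn.continuousAt hfn)
    refine hc (?_ : _ ∈ nhds (M (f x)))
    rw [hMe]
    exact e.nhds
  have hkey : ∀ z, (∀ i, g i z = L z (v i z)) →
      M (f z) ∈ range ((↑) : ((b → ℝ) ≃L[ℝ] X) → (b → ℝ) →L[ℝ] X) →
      (D (f z)).comp (ContinuousLinearMap.inverse (M (f z))) = L z := by
    rintro z hz ⟨e', he'⟩
    have hDM : D (f z) = (L z).comp (M (f z)) := by
      ext c
      simp [D, M, f, hz]
    rw [hDM, ← he', ContinuousLinearMap.inverse_equiv]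
    ext c
    simp
  refine ⟨C, t ∩ {z | (∀ i, g i z = L z (v i z)) ∧
    M (f z) ∈ range ((↑) : ((b → ℝ) ≃L[ℝ] X) → (b → ℝ) →L[ℝ] X)},
    Filter.inter_mem ht (hL.and hinv), ?_⟩
  intro z hz w hw
  rw [← hkey z hz.2.1 hz.2.2, ← hkey w hw.2.1 hw.2.2]
  exact hC hz.1 hw.1

theorem second_order_identities_of_linear_relation {k : ℕ} {s : EuclideanSpace ℝ (Fin k) → ℝ}
    {u : EuclideanSpace ℝ (Fin k) → EuclideanSpace ℝ (Fin k)}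
    {h : EuclideanSpace ℝ (Fin k) → Fin k → Fin k → ℝ} {x : EuclideanSpace ℝ (Fin k)}
    (hs : ∀ᶠ z in nhds x, DifferentiableAt ℝ s z) (hu : DifferentiableAt ℝ u x)
    (hrel : ∀ᶠ z in nhds x, ∀ l, pd s l z = ∑ i, h z l i * u z i)
    (hh : DifferentiableAt ℝ h x ∨ ContinuousAt h x ∧ u x = 0) (l m : Fin k) :
    pd (pd s l) m x = (∑ i, (pd (fun z => h z l i) m x * u x i
        + h x l i * pd (fun z => u z i) m x)) ∧
      pd (pd s l) m x = pd (pd s m) l x := by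
  have hui : ∀ i, HasFDerivAt (fun z => u z i) (fderiv ℝ (fun z => u z i) x) x := fun i =>
    ((EuclideanSpace.proj (𝕜 := ℝ) i).differentiableAt.comp x hu).hasFDerivAt
  have hprod : ∀ l i, HasFDerivAt (fun z => h z l i * u z i)
      (u x i • fderiv ℝ (fun z => h z l i) x + h x l i • fderiv ℝ (fun z => u z i) x) x := by
    intro l i
    rcases hh with hh | ⟨hh, hux⟩
    · have hd : DifferentiableAt ℝ (fun z => h z l i) x :=
        differentiableAt_pi.1 (differentiableAt_pi.1 hh l) i
      rw [add_comm]
      exact hd.hasFDerivAt.mul (hui i)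
    · have hc : ContinuousAt (fun z => h z l i) x :=
        continuousAt_pi.1 (continuousAt_pi.1 hh l) i
      have := HasFDerivAt.mul_of_right_eq_zero hc (hui i) (by simp [hux])
      simpa [hux] using this
  have hpd : ∀ l, HasFDerivAt (pd s l) (∑ i, (u x i • fderiv ℝ (fun z => h z l i) x
      + h x l i • fderiv ℝ (fun z => u z i) x)) x := fun l =>
    (HasFDerivAt.fun_sum fun i _ => hprod l i).congr_of_eventuallyEq (hrel.mono fun z hz => hz l)
  have hfd : DifferentiableAt ℝ (fderiv ℝ s) x := by
    have heq : fderiv ℝ s = fun z => ∑ l, pd s l z • EuclideanSpace.proj (𝕜 := ℝ) l := by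
      ext z w
      conv_lhs => rw [← (EuclideanSpace.basisFun (Fin k) ℝ).sum_repr w]
      simp [pd, mul_comm]
    rw [heq]
    exact DifferentiableAt.fun_sum fun l _ => (hpd l).differentiableAt.smul_const _
  have hsecond : ∀ l m, pd (pd s l) m x = fderiv ℝ (fderiv ℝ s) x (EuclideanSpace.single m 1)
      (EuclideanSpace.single l 1) := by
    intro l m
    have := (ContinuousLinearMap.apply ℝ ℝ (EuclideanSpace.single l (1 : ℝ))).hasFDerivAt.comp x
      hfd.hasFDerivAt
    exact congrArg (fun φ => φ (EuclideanSpace.single m 1)) this.fderiv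
  constructor
  · rw [pd, (hpd l).fderiv]
    simp [pd, mul_comm]
  · rw [hsecond, hsecond]
    exact second_derivative_symmetric_of_eventually (hs.mono fun z hz => hz.hasFDerivAt)
      hfd.hasFDerivAt _ _

theorem integral_mixture {E Y : Type*} [MeasurableSpace E] [NormedAddCommGroup Y]
    [NormedSpace ℝ Y] {μ ν : Measure E} {f : E → Y} (hμ : Integrable f μ) (hν : Integrable f ν)
    {a b : ℝ} (ha : 0 ≤ a) (hb : 0 ≤ b) :
    ∫ y, f y ∂(ENNReal.ofReal a • μ + ENNReal.ofReal b • ν) =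
      a • ∫ y, f y ∂μ + b • ∫ y, f y ∂ν := by
  rw [integral_add_measure (hμ.smul_measure ENNReal.ofReal_ne_top)
    (hν.smul_measure ENNReal.ofReal_ne_top), integral_smul_measure, integral_smul_measure,
    ENNReal.toReal_ofReal ha, ENNReal.toReal_ofReal hb]

/-- **second-order identities in Osband's principle.** Under (V1), (V2) and
(S3), the locally Lipschitz function `h` of Osband's principle satisfies the second-order
identities for all `l, m`, all `F ∈ 𝓕` and (Lebesgue-)almost all `x ∈ int(A)`, and in
particular for `x = T(F)` whenever `T(F) ∈ int(A)`. -/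
theorem statement12 {E : Type*} [MeasurableSpace E] {k : ℕ}
    (𝓕 : Set (Measure E)) (hprob : ∀ μ ∈ 𝓕, IsProbabilityMeasure μ)
    (hconv : ConvexClass 𝓕)
    (A : Set (EuclideanSpace ℝ (Fin k)))
    (T : Measure E → EuclideanSpace ℝ (Fin k)) (hT : ∀ μ ∈ 𝓕, T μ ∈ A)
    (hsurj : ∀ x ∈ A, ∃ μ ∈ 𝓕, T μ = x)
    (V : EuclideanSpace ℝ (Fin k) → E → EuclideanSpace ℝ (Fin k))
    (hV : IsStrictIdentification 𝓕 A T V)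
    (S : EuclideanSpace ℝ (Fin k) → E → ℝ)
    (hS : IsStrictlyConsistentScoring 𝓕 A T S)
    -- Assumption (V1):
    (hV1 : ∀ x ∈ interior A, ∃ G : Fin (k + 1) → Measure E, (∀ i, G i ∈ 𝓕) ∧
      (0 : EuclideanSpace ℝ (Fin k)) ∈
        interior (convexHull ℝ (Set.range fun i => ∫ y, V x y ∂(G i))))
    -- Assumption (V2):
    (hV2 : ∀ μ ∈ 𝓕, ContDiffOn ℝ 1 (fun x => ∫ y, V x y ∂μ) (interior A))
    -- Assumption (S3):
    (hS3 : ∀ μ ∈ 𝓕,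
      ContDiffOn ℝ 1 (fun x => ∫ y, S x y ∂μ) (interior A) ∧
      LocLipschitzOn (fun x => fderiv ℝ (fun z => ∫ y, S z y ∂μ) x) (interior A) ∧
      (T μ ∈ interior A → ContDiffAt ℝ 2 (fun x => ∫ y, S x y ∂μ) (T μ))) :
    ∃ h : EuclideanSpace ℝ (Fin k) → Fin k → Fin k → ℝ,
      (∀ x ∈ interior A, ∀ μ ∈ 𝓕, ∀ l : Fin k,
        pd (fun z => ∫ y, S z y ∂μ) l x = ∑ m : Fin k, h x l m * (∫ y, V x y ∂μ) m) ∧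
      LocLipschitzOn h (interior A) ∧
      ∀ μ ∈ 𝓕, ∀ l m : Fin k,
        (∀ᵐ x ∂(volume : Measure (EuclideanSpace ℝ (Fin k))),
          x ∈ interior A → SecondOrderId h V S μ l m x) ∧
        (T μ ∈ interior A → SecondOrderId h V S μ l m (T μ)) := by
  let U := interior A
  have hU : IsOpen U := isOpen_interior
  have hUA : U ⊆ A := interior_subset
  let v : 𝓕 → EuclideanSpace ℝ (Fin k) → EuclideanSpace ℝ (Fin k) := fun μ x => ∫ y, V x y ∂μ.1
  let s : 𝓕 → EuclideanSpace ℝ (Fin k) → ℝ := fun μ x => ∫ y, S x y ∂μ.1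
  have hs : ∀ μ, ∀ x ∈ U, DifferentiableAt ℝ (s μ) x := fun μ x hx =>
    ((hS3 μ.1 μ.2).1.contDiffAt (hU.mem_nhds hx)).differentiableAt one_ne_zero
  have hv : ∀ μ, ∀ x ∈ U, ContDiffAt ℝ 1 (v μ) x := fun μ x hx =>
    (hV2 μ.1 μ.2).contDiffAt (hU.mem_nhds hx)
  let W : EuclideanSpace ℝ (Fin k) →
      Set (EuclideanSpace ℝ (Fin k) × (EuclideanSpace ℝ (Fin k) →L[ℝ] ℝ)) :=
    fun x => range fun μ => (v μ x, fderiv ℝ (s μ) x)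
  have hW : ∀ x ∈ U, Convex ℝ (W x) := by
    intro x hx
    rw [convex_iff_forall_pos]
    rintro _ ⟨μ, rfl⟩ _ ⟨ν, rfl⟩ a b ha hb hab
    obtain rfl : a = 1 - b := by linarith
    refine ⟨⟨_, hconv μ.1 μ.2 ν.1 ν.2 b ⟨hb, by linarith⟩⟩, Prod.ext ?_ ?_⟩
    · exact integral_mixture (hV.1 _ μ.2 x (hUA hx)) (hV.1 _ ν.2 x (hUA hx)) ha.le hb.le
    · refine HasFDerivAt.fderiv ?_
      refine (((hs μ x hx).hasFDerivAt.const_smul (1 - b)).add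
        ((hs ν x hx).hasFDerivAt.const_smul b)).congr_of_eventuallyEq ?_
      filter_upwards [hU.mem_nhds hx] with z hz
      exact integral_mixture (hS.1.1 _ μ.2 z (hUA hz)) (hS.1.1 _ ν.2 z (hUA hz)) ha.le hb.le
  have hW0 : ∀ x ∈ U, ∀ w ∈ W x, w.1 = 0 → w.2 = 0 := by
    rintro x hx _ ⟨μ, rfl⟩ hw
    have hxT : x = T μ.1 := (hV.2 μ.1 μ.2 x (hUA hx)).1 hw
    have hmin : IsLocalMin (s μ) x := by
      filter_upwards [hU.mem_nhds hx] with z hz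
      simpa only [s, hxT] using hS.1.2 μ.1 μ.2 z (hUA hz)
    exact hmin.fderiv_eq_zero
  have h_int : ∀ x ∈ U, (0 : EuclideanSpace ℝ (Fin k)) ∈ interior (Prod.fst '' W x) := by
    intro x hx
    obtain ⟨G, hG, hG0⟩ := hV1 x hx
    refine interior_mono (convexHull_min ?_ ((hW x hx).linear_image (LinearMap.fst ℝ _ _))) hG0
    rintro _ ⟨i, rfl⟩
    exact ⟨_, ⟨⟨G i, hG i⟩, rfl⟩, rfl⟩
  have hspan : ∀ x ∈ U, Submodule.span ℝ (range fun μ => v μ x) = ⊤ := by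
    intro x hx
    apply Submodule.eq_top_of_nonempty_interior'
    refine ⟨0, interior_mono ?_ (h_int x hx)⟩
    rintro _ ⟨_, ⟨μ, rfl⟩, rfl⟩
    exact Submodule.subset_span ⟨μ, rfl⟩
  have hex : ∀ x, ∃ L : EuclideanSpace ℝ (Fin k) →L[ℝ] EuclideanSpace ℝ (Fin k) →L[ℝ] ℝ,
      x ∈ U → ∀ μ, fderiv ℝ (s μ) x = L (v μ x) := by
    intro x
    by_cases hx : x ∈ U
    · obtain ⟨L, hL⟩ := exists_linearMap_of_convex (hW x hx) (hW0 x hx) (h_int x hx)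
      exact ⟨LinearMap.toContinuousLinearMap L, fun _ μ => hL _ ⟨μ, rfl⟩⟩
    · exact ⟨0, fun h => absurd h hx⟩
  choose L hL using hex
  let φ : (EuclideanSpace ℝ (Fin k) →L[ℝ] EuclideanSpace ℝ (Fin k) →L[ℝ] ℝ) →
      Fin k → Fin k → ℝ :=
    fun Λ l i => Λ (EuclideanSpace.single i 1) (EuclideanSpace.single l 1)
  have hφ : ContDiff ℝ 1 φ := by
    refine contDiff_pi.2 fun l => contDiff_pi.2 fun i => ?_
    exact (contDiff_id.clm_apply contDiff_const).clm_apply contDiff_const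
  have hrel : ∀ x ∈ U, ∀ μ l, pd (s μ) l x = ∑ i, (φ ∘ L) x l i * v μ x i := by
    intro x hx μ l
    rw [pd, hL x hx μ]
    conv_lhs => rw [← (EuclideanSpace.basisFun (Fin k) ℝ).sum_repr (v μ x)]
    simp [φ, mul_comm]
  have hlip : LocLipschitzOn (φ ∘ L) U := by
    refine locLipschitzOn_of_exists_nhds fun x hx => ?_
    obtain ⟨K, t, ht, hK⟩ := exists_lipschitzOnWith_of_linear_relation
      (g := fun μ z => fderiv ℝ (s μ) z) (fun μ => hv μ x hx)
      (fun μ => (hS3 μ.1 μ.2).2.1.exists_lipschitzOnWith_nhds hU hx)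
      (Filter.mem_of_superset (hU.mem_nhds hx) hL) (hspan x hx)
    exact hK.exists_comp_contDiffAt ht hφ.contDiffAt
  have hsecond : ∀ (μ : 𝓕) (l m : Fin k), ∀ x ∈ U, (DifferentiableAt ℝ (φ ∘ L) x ∨
      ContinuousAt (φ ∘ L) x ∧ v μ x = 0) → SecondOrderId (φ ∘ L) V S μ.1 l m x := by
    intro μ l m x hx hh
    have key := second_order_identities_of_linear_relation
      (Filter.mem_of_superset (hU.mem_nhds hx) (hs μ))
      ((hv μ x hx).differentiableAt one_ne_zero)
      (Filter.mem_of_superset (hU.mem_nhds hx) fun z hz => hrel z hz μ) hh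
    have hlm := key l m
    have hml := key m l
    exact ⟨hlm.1, hlm.1.symm.trans (hlm.2.trans hml.1), hml.1.symm⟩
  refine ⟨φ ∘ L, fun x hx μ hμ l => hrel x hx ⟨μ, hμ⟩ l, hlip, fun μ hμ l m => ⟨?_, fun hx => ?_⟩⟩
  · filter_upwards [hlip.ae_differentiableAt hU volume] with x hx hxU
    exact hsecond ⟨μ, hμ⟩ l m x hxU (Or.inl (hx hxU))
  · obtain ⟨K, t, ht, hK⟩ := hlip.exists_lipschitzOnWith_nhds hU hx
    exact hsecond ⟨μ, hμ⟩ l m (T μ) hx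
      (Or.inr ⟨hK.continuousOn.continuousAt ht, (hV.2 μ hμ _ (hT μ hμ)).2 rfl⟩)
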